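/- Fix an integer n ≥ 1 and define the R-linear map f : E_n → D_n ⊗_R B_n by: f(w_i) = w_i⊗v for odd i ≤ −1; f(w₁) = w₁⊗(v+t) + z₀⊗r₁; f(w_i) = w_i⊗(v+t) for odd i ≥ 3; f(z_i) = z_i⊗v for even i ≤ 0; f(z_i) = z_i⊗(v+t) for even i ≥ 2; f(r₀) = z₀⊗r₀; f(r₋₁) = z₀⊗r₋₁; f(r₁) = z₀⊗r₁; f(t) = z₀⊗t. Then f is a grading-preserving chain map, it satisfies f∘τ_E = (τ_D⊗τ_B)∘f, and it induces an isomorphism on homology after tensoring over R with F₂[U^{±1}, V^{±1}]. -/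

import Mathlib

open Finsupp

/-- The field with two elements. -/
abbrev F2 : Type := ZMod 2

/-- The ring `R = F₂[U,V]`: `U = X 0`, `V = X 1`. -/
abbrev R2 : Type := MvPolynomial (Fin 2) F2

noncomputable def UU : R2 := MvPolynomial.X 0
noncomputable def VV : R2 := MvPolynomial.X 1

/-- The involution of `R = F₂[U,V]` exchanging `U` and `V`. -/
noncomputable def swUV : R2 →+* R2 :=
  (MvPolynomial.rename (Equiv.swap (0 : Fin 2) 1)).toRingHom

/-- The skew-equivariant (semilinear over `swUV`) extension of a map given on basis
elements. -/
noncomputable def skewExt {β γ : Type} (f : β → (γ →₀ R2)) :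
    (β →₀ R2) → (γ →₀ R2) :=
  fun ξ => Finsupp.linearCombination R2 f (ξ.mapRange (swUV ·) (map_zero _))

/-- The element `f ⊗ g` in the concrete realization `β × γ →₀ R` of the tensor product
of free `R`-modules. -/
noncomputable def tp {β γ : Type} (f : β →₀ R2) (g : γ →₀ R2) : (β × γ) →₀ R2 :=
  f.sum fun a c => g.sum fun b c' => Finsupp.single (a, b) (c * c')

/-- Homogeneity of bidegree `deg` in a free bigraded `R`-module. -/
def Homog {β : Type} (g : β → ℤ × ℤ) (deg : ℤ × ℤ) (ξ : β →₀ R2) : Prop :=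
  ∀ b ∈ ξ.support, ∀ m ∈ (ξ b).support,
    (g b).1 - 2 * (m 0 : ℤ) = deg.1 ∧ (g b).2 - 2 * (m 1 : ℤ) = deg.2

/-! ### The staircase complex `D_n` -/

abbrev WIdx (n : ℤ) := {k : ℤ // k % 2 = 1 ∧ -(4*n - 3) ≤ k ∧ k ≤ 4*n - 3}
abbrev ZIdx (n : ℤ) := {l : ℤ // l % 2 = 0 ∧ -(4*n - 2) ≤ l ∧ l ≤ 4*n - 2}
abbrev DBs (n : ℤ) := WIdx n ⊕ ZIdx n
abbrev Dc (n : ℤ) := DBs n →₀ R2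

noncomputable def wD (n k : ℤ) : Dc n :=
  if h : k % 2 = 1 ∧ -(4*n - 3) ≤ k ∧ k ≤ 4*n - 3 then single (.inl ⟨k, h⟩) 1 else 0
noncomputable def zD (n l : ℤ) : Dc n :=
  if h : l % 2 = 0 ∧ -(4*n - 2) ≤ l ∧ l ≤ 4*n - 2 then single (.inr ⟨l, h⟩) 1 else 0

/-- The differential of `D_n`:
`∂w_k = V^{⌈(k+4n−1)/4⌉} z_{k−1} + U^{⌈(4n−1−k)/4⌉} z_{k+1}` (`⌈m/4⌉ = ⌊(m+3)/4⌋`). -/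
noncomputable def dD (n : ℤ) : Dc n →ₗ[R2] Dc n :=
  linearCombination R2 fun b => match b with
  | .inl ⟨k, _⟩ =>
      VV ^ (((k + 4*n + 2)/4).toNat) • zD n (k - 1) +
        UU ^ (((4*n + 2 - k)/4).toNat) • zD n (k + 1)
  | .inr _ => 0

/-- Basis values of the reflection involution `τ_D` of `D_n`. -/
noncomputable def τDb (n : ℤ) : DBs n → Dc n := fun b => match b with
  | .inl ⟨k, _⟩ => wD n (-k)
  | .inr ⟨l, _⟩ => zD n (-l)

/-! ### The complex `E_n = D_n ⊕ S_n` and the map `τ_E` -/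

/-- Basis of the square complex `S_n`: `r₀, r₋₁, r₁, t`. -/
inductive SB : Type | r0 : SB | rm : SB | rp : SB | t : SB

abbrev EB (n : ℤ) := DBs n ⊕ SB
abbrev Ec (n : ℤ) := EB n →₀ R2

noncomputable def wE (n k : ℤ) : Ec n :=
  if h : k % 2 = 1 ∧ -(4*n - 3) ≤ k ∧ k ≤ 4*n - 3 then single (.inl (.inl ⟨k, h⟩)) 1 else 0
noncomputable def zE (n l : ℤ) : Ec n :=
  if h : l % 2 = 0 ∧ -(4*n - 2) ≤ l ∧ l ≤ 4*n - 2 then single (.inl (.inr ⟨l, h⟩)) 1 else 0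
noncomputable def sE (n : ℤ) (s : SB) : Ec n := single (.inr s) 1

/-- The differential of `E_n = D_n ⊕ S_n`. -/
noncomputable def dE (n : ℤ) : Ec n →ₗ[R2] Ec n :=
  linearCombination R2 fun b => match b with
  | .inl (.inl ⟨k, _⟩) =>
      VV ^ (((k + 4*n + 2)/4).toNat) • zE n (k - 1) +
        UU ^ (((4*n + 2 - k)/4).toNat) • zE n (k + 1)
  | .inl (.inr _) => 0
  | .inr SB.r0 => VV ^ n.toNat • sE n SB.rm + UU ^ n.toNat • sE n SB.rp
  | .inr SB.rm => UU ^ n.toNat • sE n SB.t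
  | .inr SB.rp => VV ^ n.toNat • sE n SB.t
  | .inr SB.t => 0

/-- The skew-equivariant map `τ_E` of `E_n`. -/
noncomputable def τE (n : ℤ) : Ec n → Ec n :=
  skewExt fun b => match b with
  | .inl (.inl ⟨k, _⟩) =>
      if k = -1 then wE n 1 + sE n SB.rp
      else if k = 1 then wE n (-1) + sE n SB.rm
      else wE n (-k)
  | .inl (.inr ⟨l, _⟩) => if l = 0 then zE n 0 + sE n SB.t else zE n (-l)
  | .inr SB.r0 => sE n SB.r0
  | .inr SB.rm => sE n SB.rp
  | .inr SB.rp => sE n SB.rm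
  | .inr SB.t => sE n SB.t

/-! ### The box complex `B_n` -/

/-- Basis of the box complex `B_n`: `v, r₀, r₋₁, r₁, t`. -/
inductive BB : Type | v : BB | r0 : BB | rm : BB | rp : BB | t : BB

abbrev Bc : Type := BB →₀ R2

noncomputable def bB (b : BB) : Bc := single b 1

/-- The differential of `B_n`: `∂v = 0`, `∂r₀ = Vⁿ r₋₁ + Uⁿ r₁`, `∂r₋₁ = Uⁿ t`,
`∂r₁ = Vⁿ t`, `∂t = 0`. -/
noncomputable def dB (n : ℤ) : Bc →ₗ[R2] Bc :=
  linearCombination R2 fun b => match b with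
  | BB.v => 0
  | BB.r0 => VV ^ n.toNat • bB BB.rm + UU ^ n.toNat • bB BB.rp
  | BB.rm => UU ^ n.toNat • bB BB.t
  | BB.rp => VV ^ n.toNat • bB BB.t
  | BB.t => 0

/-- Basis values of the involution `τ_B` of `B_n`: `τ_B(v) = v + t`, `τ_B(r₀) = r₀`,
`τ_B(r₋₁) = r₁`, `τ_B(r₁) = r₋₁`, `τ_B(t) = t`. -/
noncomputable def τBb : BB → Bc := fun b => match b with
  | BB.v => bB BB.v + bB BB.t
  | BB.r0 => bB BB.r0
  | BB.rm => bB BB.rp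
  | BB.rp => bB BB.rm
  | BB.t => bB BB.t

/-! ### The tensor product `D_n ⊗_R B_n` -/

abbrev DBc (n : ℤ) := (DBs n × BB) →₀ R2

/-- The differential `∂ ⊗ id + id ⊗ ∂` of `D_n ⊗_R B_n`. -/
noncomputable def dDB (n : ℤ) : DBc n →ₗ[R2] DBc n :=
  linearCombination R2 fun p =>
    tp (dD n (single p.1 1)) (single p.2 1) + tp (single p.1 1) (dB n (single p.2 1))

/-- The skew-equivariant map `τ_D ⊗ τ_B` on `D_n ⊗_R B_n`. -/
noncomputable def ττDB (n : ℤ) : DBc n → DBc n :=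
  skewExt fun p => tp (τDb n p.1) (τBb p.2)

/-! ### Bigradings -/

def IsDGrading (n : ℤ) (gw gz : ℤ → ℤ × ℤ) : Prop :=
  (gz (-(4*n) + 2)).2 = 0 ∧ (gz (4*n - 2)).1 = 0 ∧
  ∀ k : ℤ, k % 2 = 1 → -(4*n - 3) ≤ k → k ≤ 4*n - 3 →
    gz (k - 1) = ((gw k).1 - 1, (gw k).2 - 1 + 2*((k + 4*n + 2)/4)) ∧
    gz (k + 1) = ((gw k).1 - 1 + 2*((4*n + 2 - k)/4), (gw k).2 - 1)

/-- Defining conditions for the bigrading of `S_n` (differential of bidegree `(−1,−1)`,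
`gr(t) = gr(z₀)`). -/
def IsSGrading (n : ℤ) (gz : ℤ → ℤ × ℤ) (gS : SB → ℤ × ℤ) : Prop :=
  gS SB.t = gz 0 ∧
  (gS SB.rm).1 - 1 = (gS SB.t).1 - 2*n ∧ (gS SB.rm).2 - 1 = (gS SB.t).2 ∧
  (gS SB.rp).1 - 1 = (gS SB.t).1 ∧ (gS SB.rp).2 - 1 = (gS SB.t).2 - 2*n ∧
  (gS SB.r0).1 - 1 = (gS SB.rm).1 ∧ (gS SB.r0).2 - 1 = (gS SB.rm).2 - 2*n ∧
  (gS SB.r0).1 - 1 = (gS SB.rp).1 - 2*n ∧ (gS SB.r0).2 - 1 = (gS SB.rp).2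

/-- Defining conditions for the bigrading of `B_n` (differential of bidegree `(−1,−1)`,
`gr(v) = gr(t) = (0,0)`). -/
def IsBGrading (n : ℤ) (gB : BB → ℤ × ℤ) : Prop :=
  gB BB.v = (0, 0) ∧ gB BB.t = (0, 0) ∧
  (gB BB.rm).1 - 1 = (gB BB.t).1 - 2*n ∧ (gB BB.rm).2 - 1 = (gB BB.t).2 ∧
  (gB BB.rp).1 - 1 = (gB BB.t).1 ∧ (gB BB.rp).2 - 1 = (gB BB.t).2 - 2*n ∧
  (gB BB.r0).1 - 1 = (gB BB.rm).1 ∧ (gB BB.r0).2 - 1 = (gB BB.rm).2 - 2*n ∧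
  (gB BB.r0).1 - 1 = (gB BB.rp).1 - 2*n ∧ (gB BB.r0).2 - 1 = (gB BB.rp).2

def grD (gw gz : ℤ → ℤ × ℤ) {n : ℤ} : DBs n → ℤ × ℤ := fun b => match b with
  | .inl ⟨k, _⟩ => gw k
  | .inr ⟨l, _⟩ => gz l

def grE (gw gz : ℤ → ℤ × ℤ) (gS : SB → ℤ × ℤ) {n : ℤ} : EB n → ℤ × ℤ := fun b =>
  match b with
  | .inl (.inl ⟨k, _⟩) => gw k
  | .inl (.inr ⟨l, _⟩) => gz l
  | .inr s => gS s

def grDB (gw gz : ℤ → ℤ × ℤ) (gB : BB → ℤ × ℤ) {n : ℤ} : DBs n × BB → ℤ × ℤ :=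
  fun p => grD gw gz p.1 + gB p.2

/-- The map `f : E_n → D_n ⊗_R B_n` of Statement 11. -/
noncomputable def fEDB (n : ℤ) : Ec n →ₗ[R2] DBc n :=
  linearCombination R2 fun b => match b with
  | .inl (.inl ⟨k, _⟩) =>
      if k ≤ -1 then tp (wD n k) (bB BB.v)
      else if k = 1 then tp (wD n 1) (bB BB.v + bB BB.t) + tp (zD n 0) (bB BB.rp)
      else tp (wD n k) (bB BB.v + bB BB.t)
  | .inl (.inr ⟨l, _⟩) =>
      if l ≤ 0 then tp (zD n l) (bB BB.v) else tp (zD n l) (bB BB.v + bB BB.t)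
  | .inr SB.r0 => tp (zD n 0) (bB BB.r0)
  | .inr SB.rm => tp (zD n 0) (bB BB.rm)
  | .inr SB.rp => tp (zD n 0) (bB BB.rp)
  | .inr SB.t => tp (zD n 0) (bB BB.t)

section FreeModules

variable {β γ M : Type}

theorem linearMap_eq_of_single [AddCommGroup M] [Module R2 M] {f g : (β →₀ R2) →ₗ[R2] M}
    (h : ∀ b, f (single b 1) = g (single b 1)) (x : β →₀ R2) : f x = g x := by
  have : f = g := by
    ext b
    simpa using h b
  rw [this]

theorem add_self_eq_zero_of_R2 (x : β →₀ R2) : x + x = 0 := by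
  ext1 b
  simpa using CharTwo.add_self_eq_zero (x b)

theorem tp_apply (f : β →₀ R2) (g : γ →₀ R2) (a : β) (b : γ) : tp f g (a, b) = f a * g b := by
  classical
  simp only [tp, Finsupp.sum_apply, Finsupp.single_apply, Prod.mk.injEq, ite_and]
  simp only [Finsupp.sum, Finset.sum_ite_eq', Finset.sum_ite_irrel, Finset.sum_const_zero]
  by_cases hf : f a = 0 <;> by_cases hg : g b = 0 <;> simp [hf, hg]

theorem tp_add_left (f f' : β →₀ R2) (g : γ →₀ R2) : tp (f + f') g = tp f g + tp f' g := by
  ext1 ⟨a, b⟩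
  simp [tp_apply, add_mul]

theorem tp_add_right (f : β →₀ R2) (g g' : γ →₀ R2) : tp f (g + g') = tp f g + tp f g' := by
  ext1 ⟨a, b⟩
  simp [tp_apply, mul_add]

theorem tp_smul_left (c : R2) (f : β →₀ R2) (g : γ →₀ R2) : tp (c • f) g = c • tp f g := by
  ext1 ⟨a, b⟩
  simp [tp_apply, mul_assoc]

theorem tp_smul_right (c : R2) (f : β →₀ R2) (g : γ →₀ R2) : tp f (c • g) = c • tp f g := by
  ext1 ⟨a, b⟩
  simp [tp_apply, mul_left_comm]

@[simp] theorem tp_zero_left (g : γ →₀ R2) : tp (0 : β →₀ R2) g = 0 := by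
  ext1 ⟨a, b⟩
  simp [tp_apply]

@[simp] theorem tp_zero_right (f : β →₀ R2) : tp f (0 : γ →₀ R2) = 0 := by
  ext1 ⟨a, b⟩
  simp [tp_apply]

theorem tp_single_single (a : β) (b : γ) (c c' : R2) :
    tp (single a c) (single b c') = single (a, b) (c * c') := by
  simp [tp]

/-- The tensor product of elements as a bilinear map. -/
noncomputable def tpBilin : (β →₀ R2) →ₗ[R2] (γ →₀ R2) →ₗ[R2] ((β × γ) →₀ R2) :=
  LinearMap.mk₂ R2 tp tp_add_left tp_smul_left tp_add_right tp_smul_right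

theorem bilin_eq_of_single [AddCommGroup M] [Module R2 M]
    {f g : (β →₀ R2) →ₗ[R2] (γ →₀ R2) →ₗ[R2] M}
    (h : ∀ a b, f (single a 1) (single b 1) = g (single a 1) (single b 1))
    (x : β →₀ R2) (y : γ →₀ R2) : f x y = g x y := by
  rw [linearMap_eq_of_single fun a => LinearMap.ext (linearMap_eq_of_single (h a))]

theorem skewExt_add (f : β → (γ →₀ R2)) (x y : β →₀ R2) :
    skewExt f (x + y) = skewExt f x + skewExt f y := by
  simp only [skewExt]
  rw [Finsupp.mapRange_add (fun a b => map_add swUV a b), map_add]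

theorem skewExt_single_one (f : β → (γ →₀ R2)) (b : β) : skewExt f (single b 1) = f b := by
  simp [skewExt]

theorem skewExt_smul (f : β → (γ →₀ R2)) (c : R2) (x : β →₀ R2) :
    skewExt f (c • x) = swUV c • skewExt f x := by
  induction x using Finsupp.induction_linear with
  | zero => simp [skewExt]
  | add x y hx hy => rw [smul_add, skewExt_add, skewExt_add, hx, hy, smul_add]
  | single b d =>
    simp only [skewExt, Finsupp.smul_single, smul_eq_mul, Finsupp.mapRange_single,
      linearCombination_single, map_mul, mul_smul]

theorem Homog.add {g : β → ℤ × ℤ} {deg : ℤ × ℤ} {x y : β →₀ R2}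
    (hx : Homog g deg x) (hy : Homog g deg y) : Homog g deg (x + y) := by
  classical
  intro b _ m hm
  rw [Finsupp.add_apply] at hm
  have hmem : ∀ z : β →₀ R2, m ∈ (z b).support → b ∈ z.support := by
    intro z hz
    rw [Finsupp.mem_support_iff]
    rintro h0
    simp [h0] at hz
  rcases Finset.mem_union.1 (MvPolynomial.support_add hm) with h | h
  · exact hx b (hmem x h) m h
  · exact hy b (hmem y h) m h

theorem homog_single {g : β → ℤ × ℤ} {deg : ℤ × ℤ} {b : β} (h : g b = deg) :
    Homog g deg (single b 1) := by
  classical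
  intro b' hb' m hm
  obtain rfl : b' = b := by simpa using hb'
  have : m = 0 := by
    simpa [MvPolynomial.mem_support_iff, MvPolynomial.coeff_one, eq_comm] using hm
  simp [this, h]

end FreeModules

section Generators

variable {n : ℤ}

theorem wD_eq_single {k : ℤ} (h : k % 2 = 1 ∧ -(4*n - 3) ≤ k ∧ k ≤ 4*n - 3) :
    wD n k = single (.inl ⟨k, h⟩) 1 := dif_pos h

theorem zD_eq_single {l : ℤ} (h : l % 2 = 0 ∧ -(4*n - 2) ≤ l ∧ l ≤ 4*n - 2) :
    zD n l = single (.inr ⟨l, h⟩) 1 := dif_pos h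

theorem wE_eq_single {k : ℤ} (h : k % 2 = 1 ∧ -(4*n - 3) ≤ k ∧ k ≤ 4*n - 3) :
    wE n k = single (.inl (.inl ⟨k, h⟩)) 1 := dif_pos h

theorem zE_eq_single {l : ℤ} (h : l % 2 = 0 ∧ -(4*n - 2) ≤ l ∧ l ≤ 4*n - 2) :
    zE n l = single (.inl (.inr ⟨l, h⟩)) 1 := dif_pos h

theorem dD_w {k : ℤ} (h : k % 2 = 1 ∧ -(4*n - 3) ≤ k ∧ k ≤ 4*n - 3) :
    dD n (wD n k) = VV ^ (((k + 4*n + 2)/4).toNat) • zD n (k - 1) +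
        UU ^ (((4*n + 2 - k)/4).toNat) • zD n (k + 1) := by
  simp [wD_eq_single h, dD]

theorem dD_z (l : ℤ) : dD n (zD n l) = 0 := by
  unfold zD
  split_ifs <;> simp [dD]

theorem dE_w {k : ℤ} (h : k % 2 = 1 ∧ -(4*n - 3) ≤ k ∧ k ≤ 4*n - 3) :
    dE n (wE n k) = VV ^ (((k + 4*n + 2)/4).toNat) • zE n (k - 1) +
        UU ^ (((4*n + 2 - k)/4).toNat) • zE n (k + 1) := by
  simp [wE_eq_single h, dE]

theorem dE_z (l : ℤ) : dE n (zE n l) = 0 := by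
  unfold zE
  split_ifs <;> simp [dE]

theorem dE_r0 : dE n (sE n SB.r0) = VV ^ n.toNat • sE n SB.rm + UU ^ n.toNat • sE n SB.rp := by
  simp [sE, dE]

theorem dE_rm : dE n (sE n SB.rm) = UU ^ n.toNat • sE n SB.t := by simp [sE, dE]

theorem dE_rp : dE n (sE n SB.rp) = VV ^ n.toNat • sE n SB.t := by simp [sE, dE]

theorem dE_t : dE n (sE n SB.t) = 0 := by simp [sE, dE]

theorem dB_v : dB n (bB BB.v) = 0 := by simp [bB, dB]

theorem dB_r0 : dB n (bB BB.r0) = VV ^ n.toNat • bB BB.rm + UU ^ n.toNat • bB BB.rp := by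
  simp [bB, dB]

theorem dB_rm : dB n (bB BB.rm) = UU ^ n.toNat • bB BB.t := by simp [bB, dB]

theorem dB_rp : dB n (bB BB.rp) = VV ^ n.toNat • bB BB.t := by simp [bB, dB]

theorem dB_t : dB n (bB BB.t) = 0 := by simp [bB, dB]

theorem fEDB_w {k : ℤ} (h : k % 2 = 1 ∧ -(4*n - 3) ≤ k ∧ k ≤ 4*n - 3) :
    fEDB n (wE n k) =
      if k ≤ -1 then tp (wD n k) (bB BB.v)
      else if k = 1 then tp (wD n 1) (bB BB.v + bB BB.t) + tp (zD n 0) (bB BB.rp)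
      else tp (wD n k) (bB BB.v + bB BB.t) := by
  simp [wE_eq_single h, fEDB]

theorem fEDB_z (l : ℤ) :
    fEDB n (zE n l) =
      if l ≤ 0 then tp (zD n l) (bB BB.v) else tp (zD n l) (bB BB.v + bB BB.t) := by
  by_cases h : l % 2 = 0 ∧ -(4*n - 2) ≤ l ∧ l ≤ 4*n - 2
  · simp [zE_eq_single h, fEDB]
  · rw [zE, zD, dif_neg h, dif_neg h]
    simp

theorem fEDB_r0 : fEDB n (sE n SB.r0) = tp (zD n 0) (bB BB.r0) := by simp [sE, fEDB]

theorem fEDB_rm : fEDB n (sE n SB.rm) = tp (zD n 0) (bB BB.rm) := by simp [sE, fEDB]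

theorem fEDB_rp : fEDB n (sE n SB.rp) = tp (zD n 0) (bB BB.rp) := by simp [sE, fEDB]

theorem fEDB_t : fEDB n (sE n SB.t) = tp (zD n 0) (bB BB.t) := by simp [sE, fEDB]

theorem dDB_tp (x : Dc n) (y : Bc) :
    dDB n (tp x y) = tp (dD n x) y + tp x (dB n y) := by
  have := bilin_eq_of_single (f := tpBilin.compr₂ (dDB n))
    (g := tpBilin.comp (dD n) + tpBilin.compl₂ (dB n)) (fun a b => by
      simp [tpBilin, tp_single_single, dDB]) x y
  simpa [tpBilin] using this

theorem Ec_basis_cases {P : Ec n → Prop}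
    (hw : ∀ k : ℤ, k % 2 = 1 ∧ -(4*n - 3) ≤ k ∧ k ≤ 4*n - 3 → P (wE n k))
    (hz : ∀ l : ℤ, l % 2 = 0 ∧ -(4*n - 2) ≤ l ∧ l ≤ 4*n - 2 → P (zE n l))
    (hs : ∀ s, P (sE n s)) (b : EB n) : P (single b 1) := by
  rcases b with (⟨k, h⟩ | ⟨l, h⟩) | s
  · exact wE_eq_single h ▸ hw k h
  · exact zE_eq_single h ▸ hz l h
  · exact hs s

end Generators

theorem fEDB_homog {n : ℤ} (hn : 1 ≤ n) {gw gz : ℤ → ℤ × ℤ} {gS : SB → ℤ × ℤ} {gB : BB → ℤ × ℤ}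
    (hD : IsDGrading n gw gz) (hS : IsSGrading n gz gS) (hB : IsBGrading n gB) (b : EB n) :
    Homog (grDB gw gz gB) (grE gw gz gS b) (fEDB n (single b 1)) := by
  have h0 : (0 : ℤ) % 2 = 0 ∧ -(4*n - 2) ≤ 0 ∧ 0 ≤ 4*n - 2 := by omega
  obtain ⟨-, -, hD⟩ := hD
  have hD1 := (hD 1 (by norm_num) (by omega) (by omega)).1
  have hdiv : (1 + 4 * n + 2) / 4 = n := by omega
  rw [hdiv, sub_self] at hD1
  obtain ⟨hv, ht, hB⟩ := hB
  obtain ⟨hSt, hS⟩ := hS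
  simp only [Prod.ext_iff] at hv ht hSt hD1
  rcases b with (⟨k, h⟩ | ⟨l, h⟩) | s
  · rw [← wE_eq_single h, fEDB_w h]
    split_ifs with h1 h2
    · rw [wD_eq_single h, bB, tp_single_single, one_mul]
      apply homog_single
      simp [grDB, grE, grD, Prod.ext_iff, hv]
    · subst h2
      rw [tp_add_right, wD_eq_single h, zD_eq_single h0]
      simp only [bB, tp_single_single, one_mul]
      refine ((homog_single ?_).add (homog_single ?_)).add (homog_single ?_) <;>
        simp only [grDB, grE, grD, Prod.ext_iff, Prod.fst_add, Prod.snd_add] <;> omega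
    · rw [tp_add_right, wD_eq_single h]
      simp only [bB, tp_single_single, one_mul]
      refine (homog_single ?_).add (homog_single ?_) <;>
        simp [grDB, grE, grD, Prod.ext_iff, hv, ht]
  · rw [← zE_eq_single h, fEDB_z]
    split_ifs with h1
    · rw [zD_eq_single h, bB, tp_single_single, one_mul]
      apply homog_single
      simp [grDB, grE, grD, Prod.ext_iff, hv]
    · rw [tp_add_right, zD_eq_single h]
      simp only [bB, tp_single_single, one_mul]
      refine (homog_single ?_).add (homog_single ?_) <;>
        simp [grDB, grE, grD, Prod.ext_iff, hv, ht]
  · cases s <;> simp only [fEDB, linearCombination_single, one_smul] <;>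
      rw [zD_eq_single h0] <;> simp only [bB, tp_single_single, one_mul] <;>
      apply homog_single <;>
      simp only [grDB, grE, grD, Prod.ext_iff, Prod.fst_add, Prod.snd_add] <;> omega

theorem fEDB_dE {n : ℤ} (x : Ec n) : fEDB n (dE n x) = dDB n (fEDB n x) := by
  refine linearMap_eq_of_single (f := (fEDB n) ∘ₗ (dE n)) (g := (dDB n) ∘ₗ (fEDB n)) ?_ x
  simp only [LinearMap.comp_apply]
  refine Ec_basis_cases (P := fun e => fEDB n (dE n e) = dDB n (fEDB n e)) ?_ ?_ ?_
  · intro k h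
    rw [dE_w h, map_add, map_smul, map_smul, fEDB_z, fEDB_z, fEDB_w h]
    rcases lt_trichotomy k 1 with h1 | rfl | h1
    · rw [if_pos (by omega), if_pos (by omega), if_pos (by omega), dDB_tp, dD_w h, dB_v,
        tp_zero_right, add_zero, tp_add_left, tp_smul_left, tp_smul_left]
    · have hdiv : (1 + 4 * n + 2) / 4 = n := by omega
      norm_num [hdiv, dDB_tp, dD_w h, dB_v, dB_t, dB_rp, dD_z, tp_add_left, tp_add_right,
        tp_smul_left, tp_smul_right]
      have h2 := add_self_eq_zero_of_R2 (VV ^ n.toNat • tp (zD n 0) (bB BB.t))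
      linear_combination (norm := module) (-1 : R2) • h2
    · rw [if_neg (by omega), if_neg (by omega), if_neg (by omega), if_neg (by omega), dDB_tp,
        dD_w h, map_add, dB_v, dB_t, add_zero,
        tp_zero_right, add_zero, tp_add_left, tp_smul_left, tp_smul_left]
  · intro l h
    rw [dE_z, fEDB_z]
    split_ifs <;> simp [dDB_tp, dD_z, dB_v, dB_t]
  · intro s
    cases s <;> simp [dE_r0, dE_rm, dE_rp, dE_t, fEDB_r0, fEDB_rm, fEDB_rp, fEDB_t, dDB_tp, dD_z,
      dB_r0, dB_rm, dB_rp, dB_t, tp_add_right, tp_smul_right]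

section Involutions

variable {n : ℤ}

theorem τE_w {k : ℤ} (h : k % 2 = 1 ∧ -(4*n - 3) ≤ k ∧ k ≤ 4*n - 3) :
    τE n (wE n k) =
      if k = -1 then wE n 1 + sE n SB.rp
      else if k = 1 then wE n (-1) + sE n SB.rm
      else wE n (-k) := by
  rw [wE_eq_single h, τE, skewExt_single_one]

theorem τE_z {l : ℤ} (h : l % 2 = 0 ∧ -(4*n - 2) ≤ l ∧ l ≤ 4*n - 2) :
    τE n (zE n l) = if l = 0 then zE n 0 + sE n SB.t else zE n (-l) := by
  rw [zE_eq_single h, τE, skewExt_single_one]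

theorem τE_r0 : τE n (sE n SB.r0) = sE n SB.r0 := skewExt_single_one _ _

theorem τE_rm : τE n (sE n SB.rm) = sE n SB.rp := skewExt_single_one _ _

theorem τE_rp : τE n (sE n SB.rp) = sE n SB.rm := skewExt_single_one _ _

theorem τE_t : τE n (sE n SB.t) = sE n SB.t := skewExt_single_one _ _

theorem ττDB_w_tp {k : ℤ} (h : k % 2 = 1 ∧ -(4*n - 3) ≤ k ∧ k ≤ 4*n - 3) (s : BB) :
    ττDB n (tp (wD n k) (bB s)) = tp (wD n (-k)) (τBb s) := by
  rw [wD_eq_single h, bB, tp_single_single, one_mul, ττDB, skewExt_single_one]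
  rfl

theorem ττDB_z_tp {l : ℤ} (h : l % 2 = 0 ∧ -(4*n - 2) ≤ l ∧ l ≤ 4*n - 2) (s : BB) :
    ττDB n (tp (zD n l) (bB s)) = tp (zD n (-l)) (τBb s) := by
  rw [zD_eq_single h, bB, tp_single_single, one_mul, ττDB, skewExt_single_one]
  rfl

theorem ττDB_add (x y : DBc n) : ττDB n (x + y) = ττDB n x + ττDB n y := skewExt_add _ x y

theorem bB_v_add_t_add_t : bB BB.v + bB BB.t + bB BB.t = bB BB.v := by
  rw [add_assoc, add_self_eq_zero_of_R2, add_zero]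

theorem fEDB_τE_basis (hn : 1 ≤ n) (b : EB n) :
    fEDB n (τE n (single b 1)) = ττDB n (fEDB n (single b 1)) := by
  have h0 : (0 : ℤ) % 2 = 0 ∧ -(4*n - 2) ≤ 0 ∧ 0 ≤ 4*n - 2 := by omega
  refine Ec_basis_cases (P := fun e => fEDB n (τE n e) = ττDB n (fEDB n e)) ?_ ?_ ?_ b
  · intro k h
    have hneg : -k % 2 = 1 ∧ -(4*n - 3) ≤ -k ∧ -k ≤ 4*n - 3 := by omega
    rw [τE_w h, fEDB_w h]
    by_cases h1 : k = -1
    · subst h1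
      rw [neg_neg] at hneg
      simp only [if_true, le_refl, map_add, fEDB_w hneg, fEDB_rp, ττDB_w_tp h, τBb, neg_neg]
      norm_num [add_assoc, add_self_eq_zero_of_R2]
    by_cases h2 : k = 1
    · subst h2
      norm_num [map_add, fEDB_w hneg, fEDB_rm, ττDB_add, tp_add_right, ττDB_w_tp h, ττDB_z_tp h0,
        τBb]
      simp [add_assoc, add_self_eq_zero_of_R2]
    rw [if_neg h1, if_neg h2, fEDB_w hneg]
    rcases lt_or_ge k 0 with h3 | h3
    · rw [if_neg (by omega), if_neg (by omega), if_pos (by omega), ττDB_w_tp h]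
      rfl
    · rw [if_pos (by omega), if_neg (by omega), if_neg (by omega), tp_add_right, ττDB_add,
        ττDB_w_tp h, ττDB_w_tp h, ← tp_add_right]
      simp only [τBb, bB_v_add_t_add_t]
  · intro l h
    rw [τE_z h, fEDB_z]
    rcases lt_trichotomy l 0 with h1 | rfl | h1
    · rw [if_neg (by omega), fEDB_z, if_neg (by omega), if_pos (by omega), ττDB_z_tp h]
      rfl
    · simp [fEDB_z, fEDB_t, ττDB_z_tp h0, τBb, tp_add_right]
    · rw [if_neg (by omega), fEDB_z, if_pos (by omega), if_neg (by omega), tp_add_right, ττDB_add,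
        ττDB_z_tp h, ττDB_z_tp h, ← tp_add_right]
      simp only [τBb, bB_v_add_t_add_t]
  · intro s
    cases s <;> simp [τE_r0, τE_rm, τE_rp, τE_t, fEDB_r0, fEDB_rm, fEDB_rp, fEDB_t, ττDB_z_tp h0, τBb]

theorem fEDB_τE (hn : 1 ≤ n) (x : Ec n) : fEDB n (τE n x) = ττDB n (fEDB n x) := by
  induction x using Finsupp.induction_linear with
  | zero => simp [τE, ττDB, skewExt]
  | add x y hx hy => rw [map_add, ττDB_add, ← hx, ← hy, ← map_add, τE, skewExt_add]
  | single b c =>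
    have hc : (single b c : Ec n) = c • single b 1 := by simp
    have h1 : τE n (c • single b 1) = swUV c • τE n (single b 1) := skewExt_smul _ _ _
    have h2 (y : DBc n) : ττDB n (c • y) = swUV c • ττDB n y := skewExt_smul _ _ _
    rw [hc, h1, map_smul, map_smul, h2, fEDB_τE_basis hn]

end Involutions

section Saturation

variable {M : Type} [AddCommGroup M] [Module R2 M]

/-- The elements that lie in `N` after multiplication by a power of `UV`. -/
noncomputable def uvSaturation (N : Submodule R2 M) : Submodule R2 M where
  carrier := {x | ∃ k : ℕ, (UU * VV) ^ k • x ∈ N}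
  zero_mem' := ⟨0, by simp⟩
  add_mem' := by
    rintro x y ⟨k, hk⟩ ⟨m, hm⟩
    refine ⟨k + m, ?_⟩
    rw [smul_add]
    refine N.add_mem ?_ ?_
    · rw [pow_add, mul_comm, mul_smul]
      exact N.smul_mem _ hk
    · rw [pow_add, mul_smul]
      exact N.smul_mem _ hm
  smul_mem' := by
    rintro c x ⟨k, hk⟩
    refine ⟨k, ?_⟩
    rw [smul_comm]
    exact N.smul_mem _ hk

theorem le_uvSaturation (N : Submodule R2 M) : N ≤ uvSaturation N :=
  fun x hx => ⟨0, by simpa using hx⟩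

theorem mem_uvSaturation_of_mul_pow_smul {N : Submodule R2 M} {x : M} (k : ℕ)
    (h : (UU * VV) ^ k • x ∈ uvSaturation N) : x ∈ uvSaturation N := by
  obtain ⟨m, hm⟩ := h
  exact ⟨m + k, by rwa [pow_add, mul_smul]⟩

theorem U_pow_smul_mem_uvSaturation_iff {N : Submodule R2 M} {x : M} (k : ℕ) :
    UU ^ k • x ∈ uvSaturation N ↔ x ∈ uvSaturation N := by
  refine ⟨fun h => mem_uvSaturation_of_mul_pow_smul k ?_, Submodule.smul_mem _ _⟩
  rw [mul_pow, mul_comm, mul_smul]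
  exact Submodule.smul_mem _ _ h

theorem V_pow_smul_mem_uvSaturation_iff {N : Submodule R2 M} {x : M} (k : ℕ) :
    VV ^ k • x ∈ uvSaturation N ↔ x ∈ uvSaturation N := by
  refine ⟨fun h => mem_uvSaturation_of_mul_pow_smul k ?_, Submodule.smul_mem _ _⟩
  rw [mul_pow, mul_smul]
  exact Submodule.smul_mem _ _ h

end Saturation

theorem UU_ne_zero : UU ≠ 0 := MvPolynomial.X_ne_zero 0

theorem VV_ne_zero : VV ≠ 0 := MvPolynomial.X_ne_zero 1

section Staircase

variable {n : ℤ}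

theorem zD_apply (l l' : ℤ) (h : l' % 2 = 0 ∧ -(4*n - 2) ≤ l' ∧ l' ≤ 4*n - 2) :
    zD n l (.inr ⟨l', h⟩) = if l = l' then 1 else 0 := by
  by_cases hl : l = l'
  · subst hl
    simp [zD_eq_single h]
  · rw [if_neg hl]
    unfold zD
    split_ifs
    · exact Finsupp.single_eq_of_ne (by simpa using Ne.symm hl)
    · rfl

/-- The coefficient of `w_k`, which is zero by convention if `k` is out of range. -/
noncomputable def wCoeff (n k : ℤ) : Dc n →ₗ[R2] R2 :=
  if h : k % 2 = 1 ∧ -(4*n - 3) ≤ k ∧ k ≤ 4*n - 3 then Finsupp.lapply (.inl ⟨k, h⟩) else 0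

theorem wCoeff_w {k : ℤ} (k' : ℤ) (h : k % 2 = 1 ∧ -(4*n - 3) ≤ k ∧ k ≤ 4*n - 3) :
    wCoeff n k' (wD n k) = if k = k' then 1 else 0 := by
  rw [wD_eq_single h]
  by_cases hk : k = k'
  · subst hk
    rw [wCoeff, dif_pos h]
    simp
  · rw [if_neg hk]
    unfold wCoeff
    split_ifs
    · exact Finsupp.single_eq_of_ne (by simpa using Ne.symm hk)
    · rfl

theorem wCoeff_z {l : ℤ} (k' : ℤ) (h : l % 2 = 0 ∧ -(4*n - 2) ≤ l ∧ l ≤ 4*n - 2) :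
    wCoeff n k' (zD n l) = 0 := by
  rw [zD_eq_single h]
  unfold wCoeff
  split_ifs
  · exact Finsupp.single_eq_of_ne (by simp)
  · rfl

theorem Dc_basis_cases {P : Dc n → Prop}
    (hw : ∀ k : ℤ, k % 2 = 1 ∧ -(4*n - 3) ≤ k ∧ k ≤ 4*n - 3 → P (wD n k))
    (hz : ∀ l : ℤ, l % 2 = 0 ∧ -(4*n - 2) ≤ l ∧ l ≤ 4*n - 2 → P (zD n l))
    (b : DBs n) : P (single b 1) := by
  rcases b with ⟨k, h⟩ | ⟨l, h⟩
  · exact wD_eq_single h ▸ hw k h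
  · exact zD_eq_single h ▸ hz l h

theorem dD_apply_inr {l : ℤ} (h : l % 2 = 0 ∧ -(4*n - 2) ≤ l ∧ l ≤ 4*n - 2) (x : Dc n) :
    dD n x (.inr ⟨l, h⟩) =
      VV ^ ((((l + 1) + 4*n + 2)/4).toNat) * wCoeff n (l + 1) x +
        UU ^ (((4*n + 2 - (l - 1))/4).toNat) * wCoeff n (l - 1) x := by
  refine linearMap_eq_of_single (f := Finsupp.lapply (.inr ⟨l, h⟩) ∘ₗ dD n)
    (g := VV ^ ((((l + 1) + 4*n + 2)/4).toNat) • wCoeff n (l + 1) +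
        UU ^ (((4*n + 2 - (l - 1))/4).toNat) • wCoeff n (l - 1)) ?_ x
  simp only [LinearMap.comp_apply, LinearMap.add_apply, LinearMap.smul_apply,
    Finsupp.lapply_apply, smul_eq_mul]
  refine Dc_basis_cases (P := fun e => dD n e (.inr ⟨l, h⟩) =
    VV ^ ((((l + 1) + 4*n + 2)/4).toNat) * wCoeff n (l + 1) e +
        UU ^ (((4*n + 2 - (l - 1))/4).toNat) * wCoeff n (l - 1) e) ?_ ?_
  · intro k hk
    rw [dD_w hk, wCoeff_w _ hk, wCoeff_w _ hk]
    simp only [Finsupp.add_apply, Finsupp.smul_apply, zD_apply, smul_eq_mul]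
    by_cases h1 : k = l + 1
    · subst h1
      rw [if_pos (by omega), if_neg (by omega), if_pos rfl, if_neg (by omega)]
      simp
    by_cases h2 : k = l - 1
    · subst h2
      rw [if_neg (by omega), if_pos (by omega), if_neg (by omega), if_pos rfl]
      simp
    rw [if_neg (by omega), if_neg (by omega), if_neg h1, if_neg h2]
    simp
  · intro l' hl'
    rw [dD_z, wCoeff_z _ hl', wCoeff_z _ hl']
    simp

theorem wCoeff_eq_zero_of_cycle {x : Dc n} (hx : dD n x = 0) (j : ℕ) :
    wCoeff n (2 * j - (4*n - 3) - 2) x = 0 := by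
  induction j with
  | zero => rw [wCoeff, dif_neg (by omega), LinearMap.zero_apply]
  | succ j ih =>
    by_cases h : (2 * (j : ℤ) - (4*n - 3) - 1) % 2 = 0 ∧
        -(4*n - 2) ≤ 2 * (j : ℤ) - (4*n - 3) - 1 ∧ 2 * (j : ℤ) - (4*n - 3) - 1 ≤ 4*n - 2
    · have hl := dD_apply_inr h x
      rw [show 2 * (j : ℤ) - (4*n - 3) - 1 - 1 = 2 * j - (4*n - 3) - 2 by ring, ih, hx,
        mul_zero, add_zero, Finsupp.zero_apply, eq_comm, mul_eq_zero] at hl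
      have := hl.resolve_left (pow_ne_zero _ VV_ne_zero)
      rwa [show 2 * (j : ℤ) - (4*n - 3) - 1 + 1 = 2 * ((j + 1 : ℕ) : ℤ) - (4*n - 3) - 2 by
        push_cast; ring] at this
    · rw [wCoeff, dif_neg (by omega), LinearMap.zero_apply]

theorem zD_mem_uvSaturation_iff {N : Submodule R2 (Dc n)} (hN : LinearMap.range (dD n) ≤ N) (j : ℕ)
    (hj : 2 * (j : ℤ) - (4*n - 2) ≤ 4*n - 2) :
    zD n (2 * j - (4*n - 2)) ∈ uvSaturation N ↔ zD n (-(4*n - 2)) ∈ uvSaturation N := by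
  induction j with
  | zero => simp
  | succ j ih =>
    push_cast at hj ⊢
    rw [← ih (by omega)]
    have hk : (2 * (j : ℤ) - (4*n - 2) + 1) % 2 = 1 ∧ -(4*n - 3) ≤ 2 * (j : ℤ) - (4*n - 2) + 1 ∧
        2 * (j : ℤ) - (4*n - 2) + 1 ≤ 4*n - 3 := by omega
    have hmem := le_uvSaturation N
      (hN (LinearMap.mem_range_self (dD n) (wD n (2 * (j : ℤ) - (4*n - 2) + 1))))
    rw [dD_w hk, show 2 * (j : ℤ) - (4*n - 2) + 1 - 1 = 2 * j - (4*n - 2) by ring,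
      show 2 * (j : ℤ) - (4*n - 2) + 1 + 1 = 2 * (j + 1) - (4*n - 2) by ring] at hmem
    constructor
    · intro h
      rw [Submodule.add_mem_iff_left _ (Submodule.smul_mem _ _ h)] at hmem
      exact (V_pow_smul_mem_uvSaturation_iff _).1 hmem
    · intro h
      rw [Submodule.add_mem_iff_right _ (Submodule.smul_mem _ _ h)] at hmem
      exact (U_pow_smul_mem_uvSaturation_iff _).1 hmem

/-- After inverting `UV`, every cycle of `D_n` is homologous to a multiple of `z₀`. -/
theorem exists_homologous_z_zero (hn : 1 ≤ n) {x : Dc n} (hx : dD n x = 0) :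
    ∃ (k : ℕ) (c : R2) (y : Dc n), (UU * VV) ^ k • x = c • zD n 0 + dD n y := by
  set N : Submodule R2 (Dc n) := Submodule.span R2 {zD n 0} ⊔ LinearMap.range (dD n)
  have hN : LinearMap.range (dD n) ≤ N := le_sup_right
  have hz0 : zD n 0 ∈ uvSaturation N :=
    le_uvSaturation N (Submodule.mem_sup_left (Submodule.mem_span_singleton_self _))
  have hbot : zD n (-(4*n - 2)) ∈ uvSaturation N := by
    rw [← zD_mem_uvSaturation_iff hN (2 * n - 1).toNat (by omega)]
    rwa [show 2 * ((2 * n - 1).toNat : ℤ) - (4*n - 2) = 0 by omega]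
  have hmem : x ∈ uvSaturation N := by
    rw [← Finsupp.sum_single x]
    refine Submodule.sum_mem _ fun b _ => ?_
    rcases b with ⟨k, h⟩ | ⟨l, h⟩
    · have hk := wCoeff_eq_zero_of_cycle hx ((k + (4*n - 3) + 2) / 2).toNat
      rw [show 2 * (((k + (4*n - 3) + 2) / 2).toNat : ℤ) - (4*n - 3) - 2 = k by omega, wCoeff,
        dif_pos h, Finsupp.lapply_apply] at hk
      simp [hk]
    · have hs : single (.inr ⟨l, h⟩) (x (.inr ⟨l, h⟩)) = x (.inr ⟨l, h⟩) • zD n l := by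
        rw [zD_eq_single h, Finsupp.smul_single, smul_eq_mul, mul_one]
      rw [hs]
      refine Submodule.smul_mem _ _ ?_
      have := (zD_mem_uvSaturation_iff hN ((l + (4*n - 2)) / 2).toNat (by omega)).2 hbot
      rwa [show 2 * (((l + (4*n - 2)) / 2).toNat : ℤ) - (4*n - 2) = l by omega] at this
  obtain ⟨k, hk⟩ := hmem
  obtain ⟨a, ha, b, ⟨y, rfl⟩, hab⟩ := Submodule.mem_sup.1 hk
  obtain ⟨c, rfl⟩ := Submodule.mem_span_singleton.1 ha
  exact ⟨k, c, y, hab.symm⟩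

/-- The sum of the first `m` step lengths of the staircase, counted from either end. -/
def stepSum (m : ℕ) : ℕ := ∑ i ∈ Finset.range m, (2 * i + 5) / 4

/-- The augmentation `D_n → R`, sending each `z_l` to a monomial and vanishing on boundaries. -/
noncomputable def augD (n : ℤ) : Dc n →ₗ[R2] R2 :=
  linearCombination R2 fun b => match b with
  | .inl _ => 0
  | .inr ⟨l, _⟩ => UU ^ stepSum ((4*n - 2 - l) / 2).toNat * VV ^ stepSum ((l + 4*n - 2) / 2).toNat

theorem augD_z {l : ℤ} (h : l % 2 = 0 ∧ -(4*n - 2) ≤ l ∧ l ≤ 4*n - 2) :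
    augD n (zD n l) =
      UU ^ stepSum ((4*n - 2 - l) / 2).toNat * VV ^ stepSum ((l + 4*n - 2) / 2).toNat := by
  simp [zD_eq_single h, augD]

theorem augD_dD (x : Dc n) : augD n (dD n x) = 0 := by
  refine linearMap_eq_of_single (f := augD n ∘ₗ dD n) (g := 0) ?_ x
  simp only [LinearMap.comp_apply, LinearMap.zero_apply]
  refine Dc_basis_cases (P := fun e => augD n (dD n e) = 0) ?_ ?_
  · intro k h
    rw [dD_w h, map_add, map_smul, map_smul, augD_z (by omega), augD_z (by omega)]
    obtain ⟨i, hi⟩ : ∃ i : ℕ, k = 2 * i - (4*n - 3) := ⟨((k + (4*n - 3)) / 2).toNat, by omega⟩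
    obtain ⟨j, hj⟩ : ∃ j : ℕ, k = 4*n - 3 - 2 * j := ⟨((4*n - 3 - k) / 2).toNat, by omega⟩
    rw [show ((k + 4*n + 2) / 4).toNat = (2 * i + 5) / 4 by omega,
      show ((4*n + 2 - k) / 4).toNat = (2 * j + 5) / 4 by omega,
      show ((4*n - 2 - (k - 1)) / 2).toNat = j + 1 by omega,
      show ((k - 1 + 4*n - 2) / 2).toNat = i by omega,
      show ((4*n - 2 - (k + 1)) / 2).toNat = j by omega,
      show ((k + 1 + 4*n - 2) / 2).toNat = i + 1 by omega]
    simp only [stepSum, Finset.sum_range_succ, pow_add, smul_eq_mul]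
    rw [← CharTwo.add_self_eq_zero (VV ^ ((2 * i + 5) / 4) *
      (UU ^ (∑ i ∈ Finset.range j, (2 * i + 5) / 4) * UU ^ ((2 * j + 5) / 4) *
        VV ^ (∑ i ∈ Finset.range i, (2 * i + 5) / 4)))]
    ring
  · intro l h
    rw [dD_z, map_zero]

theorem eq_zero_of_smul_z_zero_eq_dD (hn : 1 ≤ n) {c : R2} {y : Dc n}
    (h : c • zD n 0 = dD n y) : c = 0 := by
  have h1 := congrArg (augD n) h
  rw [augD_dD, map_smul, augD_z (by omega), smul_eq_mul, mul_eq_zero] at h1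
  exact h1.resolve_right
    (mul_ne_zero (pow_ne_zero _ UU_ne_zero) (pow_ne_zero _ VV_ne_zero))

end Staircase

section Retractions

variable {n : ℤ}

/-- The inclusion of the summand `D_n` of `E_n`. -/
noncomputable def inclE (n : ℤ) : Dc n →ₗ[R2] Ec n := Finsupp.lmapDomain R2 R2 Sum.inl

/-- The projection of `E_n` onto its summand `D_n`. -/
noncomputable def projE (n : ℤ) : Ec n →ₗ[R2] Dc n :=
  linearCombination R2 fun b => match b with
  | .inl d => single d 1
  | .inr _ => 0

/-- A null-homotopy of `Uⁿ` on the summand `S_n` of `E_n`, extended by zero. -/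
noncomputable def homotopyE (n : ℤ) : Ec n →ₗ[R2] Ec n :=
  linearCombination R2 fun b => match b with
  | .inl _ => 0
  | .inr SB.r0 => 0
  | .inr SB.rm => 0
  | .inr SB.rp => sE n SB.r0
  | .inr SB.t => sE n SB.rm

theorem inclE_w (k : ℤ) : inclE n (wD n k) = wE n k := by
  unfold wD wE
  split_ifs <;> simp [inclE]

theorem inclE_z (l : ℤ) : inclE n (zD n l) = zE n l := by
  unfold zD zE
  split_ifs <;> simp [inclE]

theorem projE_w (k : ℤ) : projE n (wE n k) = wD n k := by
  unfold wD wE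
  split_ifs <;> simp [projE]

theorem projE_z (l : ℤ) : projE n (zE n l) = zD n l := by
  unfold zD zE
  split_ifs <;> simp [projE]

theorem projE_s (s : SB) : projE n (sE n s) = 0 := by simp [projE, sE]

theorem homotopyE_w (k : ℤ) : homotopyE n (wE n k) = 0 := by
  unfold wE
  split_ifs <;> simp [homotopyE]

theorem homotopyE_z (l : ℤ) : homotopyE n (zE n l) = 0 := by
  unfold zE
  split_ifs <;> simp [homotopyE]

theorem dE_inclE (x : Dc n) : dE n (inclE n x) = inclE n (dD n x) := by
  refine linearMap_eq_of_single (f := dE n ∘ₗ inclE n) (g := inclE n ∘ₗ dD n) ?_ x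
  simp only [LinearMap.comp_apply]
  refine Dc_basis_cases (P := fun e => dE n (inclE n e) = inclE n (dD n e)) ?_ ?_
  · intro k h
    simp only [inclE_w, inclE_z, dE_w h, dD_w h, map_add, map_smul]
  · intro l h
    rw [inclE_z, dE_z, dD_z, map_zero]

theorem dD_projE (x : Ec n) : dD n (projE n x) = projE n (dE n x) := by
  refine linearMap_eq_of_single (f := dD n ∘ₗ projE n) (g := projE n ∘ₗ dE n) ?_ x
  simp only [LinearMap.comp_apply]
  refine Ec_basis_cases (P := fun e => dD n (projE n e) = projE n (dE n e)) ?_ ?_ ?_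
  · intro k h
    simp only [projE_w, projE_z, dE_w h, dD_w h, map_add, map_smul]
  · intro l h
    rw [projE_z, dE_z, dD_z, map_zero]
  · intro s
    cases s <;> simp [projE_s, dE_r0, dE_rm, dE_rp, dE_t]

theorem homotopyE_spec (x : Ec n) :
    dE n (homotopyE n x) + homotopyE n (dE n x) + UU ^ n.toNat • inclE n (projE n x) =
      UU ^ n.toNat • x := by
  refine linearMap_eq_of_single
    (f := dE n ∘ₗ homotopyE n + homotopyE n ∘ₗ dE n + UU ^ n.toNat • (inclE n ∘ₗ projE n))
    (g := UU ^ n.toNat • LinearMap.id) ?_ x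
  simp only [LinearMap.comp_apply, LinearMap.add_apply, LinearMap.smul_apply, LinearMap.id_apply]
  refine Ec_basis_cases (P := fun e => dE n (homotopyE n e) + homotopyE n (dE n e) +
    UU ^ n.toNat • inclE n (projE n e) = UU ^ n.toNat • e) ?_ ?_ ?_
  · intro k h
    simp [homotopyE_w, homotopyE_z, projE_w, inclE_w, dE_w h]
  · intro l h
    simp [homotopyE_z, projE_z, inclE_z, dE_z]
  · have h0 : homotopyE n (sE n SB.r0) = 0 := by simp [homotopyE, sE]
    have hm : homotopyE n (sE n SB.rm) = 0 := by simp [homotopyE, sE]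
    have hp : homotopyE n (sE n SB.rp) = sE n SB.r0 := by simp [homotopyE, sE]
    have ht : homotopyE n (sE n SB.t) = sE n SB.rm := by simp [homotopyE, sE]
    intro s
    rw [projE_s, map_zero, smul_zero, add_zero]
    cases s
    · rw [h0, dE_r0, map_add, map_smul, map_smul, hm, hp]
      simp
    · rw [hm, dE_rm, map_smul, ht]
      simp
    · rw [hp, dE_rp, map_smul, ht, dE_r0, add_right_comm, add_self_eq_zero_of_R2, zero_add]
    · rw [ht, dE_t, dE_rm]
      simp

/-- A null-homotopy of `Uⁿ` on the square part of `B_n`, extended by zero. -/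
noncomputable def homotopyB : Bc →ₗ[R2] Bc :=
  linearCombination R2 fun b => match b with
  | BB.v => 0
  | BB.r0 => 0
  | BB.rm => 0
  | BB.rp => bB BB.r0
  | BB.t => bB BB.rm

theorem homotopyB_spec (b : BB) :
    dB n (homotopyB (bB b)) + homotopyB (dB n (bB b)) + UU ^ n.toNat • (bB b BB.v) • bB BB.v =
      UU ^ n.toNat • bB b := by
  have hv : homotopyB (bB BB.v) = 0 := by simp [homotopyB, bB]
  have h0 : homotopyB (bB BB.r0) = 0 := by simp [homotopyB, bB]
  have hm : homotopyB (bB BB.rm) = 0 := by simp [homotopyB, bB]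
  have hp : homotopyB (bB BB.rp) = bB BB.r0 := by simp [homotopyB, bB]
  have ht : homotopyB (bB BB.t) = bB BB.rm := by simp [homotopyB, bB]
  have hne {b : BB} (hb : BB.v ≠ b) : bB b BB.v = 0 := Finsupp.single_eq_of_ne hb
  cases b
  · have h1 : bB BB.v BB.v = 1 := Finsupp.single_eq_same
    rw [hv, dB_v, h1]
    simp
  · rw [h0, dB_r0, map_add, map_smul, map_smul, hm, hp, hne (by simp)]
    simp
  · rw [hm, dB_rm, map_smul, ht, hne (by simp)]
    simp
  · rw [hp, dB_rp, map_smul, ht, dB_r0, add_right_comm _ _ (VV ^ _ • _), add_self_eq_zero_of_R2,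
      hne (by simp)]
    simp
  · rw [ht, dB_t, dB_rm, hne (by simp)]
    simp

/-- The projection of `D_n ⊗ B_n` onto `D_n ⊗ v ≅ D_n`. -/
noncomputable def projDB (n : ℤ) : DBc n →ₗ[R2] Dc n :=
  linearCombination R2 fun p => bB p.2 BB.v • single p.1 1

/-- The homotopy `id ⊗ h` of `D_n ⊗ B_n`, where `h` is `homotopyB`. -/
noncomputable def homotopyDB (n : ℤ) : DBc n →ₗ[R2] DBc n :=
  linearCombination R2 fun p => tp (single p.1 1) (homotopyB (bB p.2))

theorem projDB_tp (x : Dc n) (y : Bc) : projDB n (tp x y) = y BB.v • x := by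
  have := bilin_eq_of_single (f := tpBilin.compr₂ (projDB n))
    (g := (LinearMap.lsmul R2 (Dc n) ∘ₗ Finsupp.lapply BB.v).flip) (fun a b => by
      simp [tpBilin, tp_single_single, projDB, bB]) x y
  simpa [tpBilin] using this

theorem homotopyDB_tp (x : Dc n) (y : Bc) : homotopyDB n (tp x y) = tp x (homotopyB y) := by
  have := bilin_eq_of_single (f := tpBilin.compr₂ (homotopyDB n))
    (g := tpBilin.compl₂ homotopyB) (fun a b => by
      simp [tpBilin, tp_single_single, homotopyDB, bB]) x y
  simpa [tpBilin] using this

theorem DBc_basis_cases {P : DBc n → Prop} (h : ∀ b s, P (tp (single b 1) (bB s)))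
    (p : DBs n × BB) : P (single p 1) := by
  have := h p.1 p.2
  rwa [bB, tp_single_single, one_mul] at this

theorem dB_apply_v (b : BB) : dB n (bB b) BB.v = 0 := by
  cases b <;> simp [dB_v, dB_r0, dB_rm, dB_rp, dB_t] <;> simp [bB]

theorem dD_projDB (x : DBc n) : dD n (projDB n x) = projDB n (dDB n x) := by
  refine linearMap_eq_of_single (f := dD n ∘ₗ projDB n) (g := projDB n ∘ₗ dDB n) ?_ x
  simp only [LinearMap.comp_apply]
  refine DBc_basis_cases (P := fun e => dD n (projDB n e) = projDB n (dDB n e)) fun b s => ?_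
  rw [dDB_tp, map_add, projDB_tp, projDB_tp, projDB_tp, dB_apply_v, map_smul, zero_smul, add_zero]

theorem homotopyDB_spec (x : DBc n) :
    dDB n (homotopyDB n x) + homotopyDB n (dDB n x) +
      UU ^ n.toNat • tp (projDB n x) (bB BB.v) = UU ^ n.toNat • x := by
  refine linearMap_eq_of_single
    (f := dDB n ∘ₗ homotopyDB n + homotopyDB n ∘ₗ dDB n +
      UU ^ n.toNat • (tpBilin.flip (bB BB.v) ∘ₗ projDB n))
    (g := UU ^ n.toNat • LinearMap.id) ?_ x
  simp only [LinearMap.comp_apply, LinearMap.add_apply, LinearMap.smul_apply, LinearMap.id_apply,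
    LinearMap.flip_apply, tpBilin, LinearMap.mk₂_apply]
  refine DBc_basis_cases (P := fun e => dDB n (homotopyDB n e) + homotopyDB n (dDB n e) +
      UU ^ n.toNat • tp (projDB n e) (bB BB.v) = UU ^ n.toNat • e) fun b s => ?_
  rw [homotopyDB_tp, dDB_tp, dDB_tp, map_add, homotopyDB_tp, homotopyDB_tp, projDB_tp,
    tp_smul_left, ← tp_smul_right, ← tp_smul_right, ← tp_smul_right, ← homotopyB_spec,
    tp_add_right, tp_add_right]
  have h2 := add_self_eq_zero_of_R2 (tp (dD n (single b 1)) (homotopyB (bB s)))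
  linear_combination (norm := module) (1 : R2) • h2

end Retractions

theorem fEDB_zE_zero (n : ℤ) : fEDB n (zE n 0) = tp (zD n 0) (bB BB.v) := by
  rw [fEDB_z, if_pos le_rfl]

theorem dDB_tp_v {n : ℤ} (x : Dc n) : dDB n (tp x (bB BB.v)) = tp (dD n x) (bB BB.v) := by
  rw [dDB_tp, dB_v, tp_zero_right, add_zero]

/-- After inverting `UV`, every homology class of `D_n ⊗ B_n` is in the image of `f`. -/
theorem exists_fEDB_homologous {n : ℤ} (hn : 1 ≤ n) {c : DBc n} (hc : dDB n c = 0) :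
    ∃ (k : ℕ) (a : Ec n) (w : DBc n),
      dE n a = 0 ∧ (UU * VV)^k • c = fEDB n a + dDB n w := by
  have hx : dD n (projDB n c) = 0 := by rw [dD_projDB, hc, map_zero]
  obtain ⟨k, r, y, hy⟩ := exists_homologous_z_zero hn hx
  have hh := homotopyDB_spec c
  rw [hc, map_zero, add_zero] at hh
  have hy' := congrArg (fun z => tp z (bB BB.v)) hy
  simp only [tp_add_left, tp_smul_left, ← dDB_tp_v, ← fEDB_zE_zero] at hy'
  refine ⟨k + n.toNat, (UU ^ n.toNat * VV ^ n.toNat * r) • zE n 0,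
    (UU ^ n.toNat * VV ^ n.toNat) • tp y (bB BB.v) +
      ((UU * VV) ^ k * VV ^ n.toNat) • homotopyDB n c, by rw [map_smul, dE_z, smul_zero], ?_⟩
  simp only [map_add, map_smul, pow_add, mul_pow _ _ n.toNat]
  linear_combination (norm := module)
    (UU ^ n.toNat * VV ^ n.toNat) • hy' - ((UU * VV) ^ k * VV ^ n.toNat) • hh

/-- After inverting `UV`, the map induced by `f` on homology is injective. -/
theorem boundary_of_fEDB_boundary {n : ℤ} (hn : 1 ≤ n) {a : Ec n} (ha : dE n a = 0)
    {k : ℕ} {w : DBc n} (hw : (UU * VV)^k • fEDB n a = dDB n w) :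
    ∃ (k : ℕ) (v : Ec n), (UU * VV)^k • a = dE n v := by
  have hx : dD n (projE n a) = 0 := by rw [dD_projE, ha, map_zero]
  obtain ⟨m, r, y, hy⟩ := exists_homologous_z_zero hn hx
  have hh := homotopyE_spec a
  rw [ha, map_zero, add_zero] at hh
  have hy' := congrArg (inclE n) hy
  simp only [map_add, map_smul, inclE_z, ← dE_inclE] at hy'
  have hb : (UU * VV) ^ m • UU ^ n.toNat • a = (UU ^ n.toNat * r) • zE n 0 +
      dE n ((UU * VV) ^ m • homotopyE n a + UU ^ n.toNat • inclE n y) := by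
    simp only [map_add, map_smul]
    linear_combination (norm := module) UU ^ n.toNat • hy' - (UU * VV) ^ m • hh
  have hf := congrArg (fun z => projDB n ((UU * VV) ^ k • fEDB n z)) hb
  have hv : bB BB.v BB.v = 1 := Finsupp.single_eq_same
  simp only [map_add, map_smul, fEDB_zE_zero, fEDB_dE, projDB_tp, hv, one_smul, smul_add,
    ← dD_projDB] at hf
  have hw' := congrArg (projDB n) hw
  simp only [map_smul, ← dD_projDB] at hw'
  have hr : ((UU * VV) ^ k * (UU ^ n.toNat * r)) • zD n 0 =
      dD n (((UU * VV) ^ m * UU ^ n.toNat) • projDB n w -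
        (UU * VV) ^ k • ((UU * VV) ^ m • projDB n (fEDB n (homotopyE n a)) +
          UU ^ n.toNat • projDB n (fEDB n (inclE n y)))) := by
    simp only [map_add, map_sub, map_smul]
    linear_combination (norm := module) ((UU * VV) ^ m * UU ^ n.toNat) • hw' - hf
  have hr0 : r = 0 := by
    have := eq_zero_of_smul_z_zero_eq_dD hn hr
    simpa [mul_eq_zero, UU_ne_zero, VV_ne_zero] using this
  rw [hr0, mul_zero, zero_smul, zero_add] at hb
  refine ⟨m + n.toNat, VV ^ n.toNat • ((UU * VV) ^ m • homotopyE n a + UU ^ n.toNat • inclE n y),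
    ?_⟩
  rw [map_smul, ← hb, pow_add, mul_pow _ _ n.toNat]
  module

/-- The map `f : E_n → D_n ⊗_R B_n` is a grading-preserving chain
map satisfying `f ∘ τ_E = (τ_D ⊗ τ_B) ∘ f`, and it induces an isomorphism on homology
after tensoring over `R` with `F₂[U^{±1}, V^{±1}]` (expressed below by saying that on
homology it becomes surjective and injective up to multiplication by powers of `UV`). -/
theorem f_is_local_equivalence (n : ℤ) (hn : 1 ≤ n) :
    -- `f` is grading-preserving:
    (∀ gw gz gS gB, IsDGrading n gw gz → IsSGrading n gz gS → IsBGrading n gB →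
      ∀ b : EB n, Homog (grDB gw gz gB) (grE gw gz gS b) (fEDB n (single b 1))) ∧
    -- `f` is a chain map:
    (∀ ξ : Ec n, fEDB n (dE n ξ) = dDB n (fEDB n ξ)) ∧
    -- `f ∘ τ_E = (τ_D ⊗ τ_B) ∘ f`:
    (∀ ξ : Ec n, fEDB n (τE n ξ) = ττDB n (fEDB n ξ)) ∧
    -- `f` induces an isomorphism on homology after inverting `UV`:
    ((∀ c : DBc n, dDB n c = 0 →
        ∃ (k : ℕ) (a : Ec n) (w : DBc n),
          dE n a = 0 ∧ (UU * VV)^k • c = fEDB n a + dDB n w) ∧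
     (∀ a : Ec n, dE n a = 0 →
        (∃ (k : ℕ) (w : DBc n), (UU * VV)^k • fEDB n a = dDB n w) →
        ∃ (k : ℕ) (v : Ec n), (UU * VV)^k • a = dE n v)) := by
  refine ⟨fun gw gz gS gB hD hS hB b => fEDB_homog hn hD hS hB b, fEDB_dE, fEDB_τE hn,
    fun c hc => exists_fEDB_homologous hn hc, ?_⟩
  rintro a ha ⟨k, w, hw⟩
  exact boundary_of_fEDB_boundary hn ha hw
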